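/- arXiv:1812.06086 — 6 statements merged into one kernel-verified Lean document; each statement's English description precedes it below -/
import Mathlib

section
/- Let n ≥ 1, let G be a subgroup of the unitary group U(n), define D(G) := sup_{X,Y ∈ S²ⁿ⁻¹} inf_{g ∈ G} ‖gX − Y‖ and M(G) := inf_{X,Y ∈ S²ⁿ⁻¹} sup_{g ∈ G} |⟨gX, Y⟩|. If λ is a real number with M(G) ≤ λ < 1, then D(G) ≥ √(2(1 − λ)). -/
/-- The action of an element of the unitary group `U(n)` on `ℂⁿ` (with its
Hermitian norm) by matrix-vector multiplication. -/
noncomputable def unitaryAct {n : ℕ} (g : Matrix.unitaryGroup (Fin n) ℂ)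
    (x : EuclideanSpace ℂ (Fin n)) : EuclideanSpace ℂ (Fin n) :=
  Matrix.toEuclideanLin (g : Matrix (Fin n) (Fin n) ℂ) x

/-- The diameter `D(G) = sup_{X,Y ∈ S²ⁿ⁻¹} inf_{g ∈ G} ‖gX − Y‖`. -/
noncomputable def diam {n : ℕ} (G : Subgroup (Matrix.unitaryGroup (Fin n) ℂ)) : ℝ :=
  sSup {d : ℝ | ∃ X Y : EuclideanSpace ℂ (Fin n), ‖X‖ = 1 ∧ ‖Y‖ = 1 ∧
    d = sInf {r : ℝ | ∃ g ∈ G, r = ‖unitaryAct g X - Y‖}}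

/-- The quantity `M(G) = inf_{X,Y ∈ S²ⁿ⁻¹} sup_{g ∈ G} |⟨gX, Y⟩|`. -/
noncomputable def MQ {n : ℕ} (G : Subgroup (Matrix.unitaryGroup (Fin n) ℂ)) : ℝ :=
  sInf {d : ℝ | ∃ X Y : EuclideanSpace ℂ (Fin n), ‖X‖ = 1 ∧ ‖Y‖ = 1 ∧
    d = sSup {r : ℝ | ∃ g ∈ G, r = ‖(inner ℂ (unitaryAct g X) Y : ℂ)‖}}

theorem unitaryAct_norm {n : ℕ} (g : Matrix.unitaryGroup (Fin n) ℂ)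
    (x : EuclideanSpace ℂ (Fin n)) : ‖unitaryAct g x‖ = ‖x‖ := by
  have h : (inner ℂ (unitaryAct g x) (unitaryAct g x) : ℂ) = inner ℂ x x := by
    unfold unitaryAct
    rw [← LinearMap.adjoint_inner_right, ← Matrix.toEuclideanLin_conjTranspose_eq_adjoint]
    congr 1
    have hg : (g : Matrix (Fin n) (Fin n) ℂ).conjTranspose * (g : Matrix (Fin n) (Fin n) ℂ) = 1 :=
      Matrix.UnitaryGroup.star_mul_self g
    ext i
    simp [Matrix.toLpLin_apply, Matrix.mulVec_mulVec, hg]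
  rw [inner_self_eq_norm_sq_to_K, inner_self_eq_norm_sq_to_K] at h
  have h2 : ‖unitaryAct g x‖ ^ 2 = ‖x‖ ^ 2 := by exact_mod_cast h
  exact (sq_eq_sq₀ (norm_nonneg _) (norm_nonneg _)).1 h2

theorem diam_ge_aux (n : ℕ) (hn : 1 ≤ n) (G : Subgroup (Matrix.unitaryGroup (Fin n) ℂ))
    (mu : ℝ) (hM : MQ G < mu) :
    Real.sqrt (2 * (1 - mu)) ≤ diam G := by
  obtain ⟨d, ⟨X, Y, hX, hY, hd⟩, hlt⟩ := exists_lt_of_csInf_lt (by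
    refine ⟨_, EuclideanSpace.single ⟨0, hn⟩ 1, EuclideanSpace.single ⟨0, hn⟩ 1, ?_, ?_, rfl⟩ <;>
      simp) hM
  have hin : ∀ g ∈ G, ‖(inner ℂ (unitaryAct g X) Y : ℂ)‖ ≤ mu := by
    intro g hg
    refine le_trans ?_ hlt.le
    rw [hd]
    refine le_csSup ⟨1, ?_⟩ ⟨g, hg, rfl⟩
    rintro r ⟨g, -, rfl⟩
    refine (norm_inner_le_norm _ _).trans ?_
    rw [unitaryAct_norm, hX, hY, one_mul]
  have h1 : Real.sqrt (2 * (1 - mu)) ≤ sInf {r : ℝ | ∃ g ∈ G, r = ‖unitaryAct g X - Y‖} := by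
    refine le_csInf ⟨_, 1, G.one_mem, rfl⟩ ?_
    rintro r ⟨g, hg, rfl⟩
    refine Real.sqrt_le_iff.2 ⟨norm_nonneg _, ?_⟩
    rw [norm_sub_sq (𝕜 := ℂ), unitaryAct_norm, hX, hY]
    have := (RCLike.re_le_norm (inner ℂ (unitaryAct g X) Y : ℂ)).trans (hin g hg)
    linarith
  refine h1.trans (le_csSup ⟨2, ?_⟩ ⟨X, Y, hX, hY, rfl⟩)
  rintro d ⟨A, B, hA, hB, rfl⟩
  refine le_trans (b := ‖unitaryAct 1 A - B‖) (csInf_le ⟨0, ?_⟩ ⟨1, G.one_mem, rfl⟩) ?_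
  · rintro r ⟨g, -, rfl⟩
    exact norm_nonneg _
  · refine (norm_sub_le _ _).trans ?_
    rw [unitaryAct_norm, hA, hB]
    norm_num

/-- If `M(G) ≤ λ < 1` then `D(G) ≥ √(2(1 − λ))`. -/
theorem diam_ge_of_M_le (n : ℕ) (hn : 1 ≤ n) (G : Subgroup (Matrix.unitaryGroup (Fin n) ℂ))
    (lam : ℝ) (hMl : MQ G ≤ lam) (hl1 : lam < 1) :
    Real.sqrt (2 * (1 - lam)) ≤ diam G := by
  refine Real.sqrt_le_iff.2
    ⟨(Real.sqrt_nonneg _).trans (diam_ge_aux n hn G (lam + 1) (by linarith)), ?_⟩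
  refine le_of_forall_pos_le_add fun e he => ?_
  have := (Real.sqrt_le_iff.1 (diam_ge_aux n hn G (lam + e / 2) (by linarith))).2
  linarith
end

section
/- Let k ≥ 2 be a natural number and let t : Fin k → ℝ satisfy 0 ≤ tᵢ ≤ 1 for every i. Then ∏_{i} tᵢ + ∏_{i} √(1 − tᵢ²) ≤ 1. -/
/-- If `k ≥ 2` and `0 ≤ tᵢ ≤ 1` for every `i ∈ Fin k`, then
`∏ᵢ tᵢ + ∏ᵢ √(1 − tᵢ²) ≤ 1`. -/
theorem prod_add_prod_sqrt_le_one (k : ℕ) (hk : 2 ≤ k) (t : Fin k → ℝ)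
    (ht0 : ∀ i, 0 ≤ t i) (ht1 : ∀ i, t i ≤ 1) :
    (∏ i, t i) + (∏ i, Real.sqrt (1 - (t i) ^ 2)) ≤ 1 := by
  obtain ⟨n, rfl⟩ : ∃ n, k = n + 2 := ⟨k - 2, by omega⟩
  have hs0 : ∀ i, 0 ≤ Real.sqrt (1 - (t i) ^ 2) := fun i => Real.sqrt_nonneg _
  have hsq : ∀ i, Real.sqrt (1 - (t i) ^ 2) ^ 2 = 1 - (t i) ^ 2 := fun i =>
    Real.sq_sqrt (by nlinarith [ht0 i, ht1 i])
  have hs1 : ∀ i, Real.sqrt (1 - (t i) ^ 2) ≤ 1 := fun i =>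
    Real.sqrt_le_one.mpr (by nlinarith [sq_nonneg (t i)])
  generalize hs : (fun i => Real.sqrt (1 - (t i) ^ 2)) = s
  have hs' : ∀ i, Real.sqrt (1 - (t i) ^ 2) = s i := fun i => congrFun hs i
  simp only [hs'] at hs0 hsq hs1
  have key : ∀ f : Fin (n + 2) → ℝ, (∀ i, 0 ≤ f i) → (∀ i, f i ≤ 1) →
      ∏ i, f i ≤ f 0 * f 1 := by
    intro f h0 h1
    rw [Fin.prod_univ_succ, Fin.prod_univ_succ, ← mul_assoc]
    exact mul_le_of_le_one_right (mul_nonneg (h0 _) (h0 _))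
      (Finset.prod_le_one (fun i _ => h0 _) (fun i _ => h1 _))
  have a := key t ht0 ht1
  have b := key s hs0 hs1
  nlinarith [sq_nonneg (t 0 - t 1), sq_nonneg (s 0 - s 1), hsq 0, hsq 1]
end

section
/- Let k ≥ 2 be a natural number and let A, B be k × k complex matrices such that for every row index i, ∑_{j} |A i j|² + ∑_{j} |B i j|² ≤ 1 (i.e., each row of the k × 2k juxtaposed matrix [A B] has Euclidean norm at most 1). Then |det A| + |det B| ≤ 1; in particular |det A + det B| ≤ 1. -/
theorem hadamard_ineq_aux (k : ℕ) (A : Matrix (Fin k) (Fin k) ℂ) :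
    ‖A.det‖ ≤ ∏ i, Real.sqrt (∑ j, ‖A i j‖ ^ 2) := by
  let v : Fin k → EuclideanSpace ℂ (Fin k) := fun i => WithLp.toLp 2 (A i)
  have hd : Module.finrank ℂ (EuclideanSpace ℂ (Fin k)) = Fintype.card (Fin k) := by simp
  let b := InnerProductSpace.gramSchmidtOrthonormalBasis hd v
  let e := EuclideanSpace.basisFun (Fin k) ℂ
  have hb : b.toBasis.det v = ∏ i, inner ℂ (b i) (v i) :=
    InnerProductSpace.gramSchmidtOrthonormalBasis_det hd v
  have h1 : e.toBasis.det v = A.det := by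
    rw [Module.Basis.det_apply, ← Matrix.det_transpose A]
    congr 1
  have h2 : ‖e.toBasis.det b‖ = 1 := e.det_to_matrix_orthonormalBasis b
  have h3 : e.toBasis.det v = e.toBasis.det b * b.toBasis.det v := by
    simp only [Module.Basis.det_apply]
    rw [← Matrix.det_mul, ← OrthonormalBasis.coe_toBasis b, Module.Basis.toMatrix_mul_toMatrix]
  rw [← h1, h3, norm_mul, h2, one_mul, hb, norm_prod]
  refine Finset.prod_le_prod (fun i _ => norm_nonneg _) fun i _ => ?_
  refine (norm_inner_le_norm _ _).trans ?_
  rw [b.orthonormal.1 i, one_mul, EuclideanSpace.norm_eq]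

theorem prod_le_two_aux (k : ℕ) (a : Fin k → ℝ) (h0 : ∀ i, 0 ≤ a i) (h1 : ∀ i, a i ≤ 1)
    (i j : Fin k) (hij : i ≠ j) : ∏ l, a l ≤ a i * a j := by
  rw [← Finset.prod_pair hij]
  exact Finset.prod_le_prod_of_subset_of_le_one (Finset.subset_univ _)
    (fun l _ => h0 l) (fun l _ _ => h1 l)

/-- If `k ≥ 2` and `A, B` are `k × k` complex matrices such that every row of the
juxtaposed `k × 2k` matrix `[A B]` has Euclidean norm at most `1`, then
`|det A| + |det B| ≤ 1`; in particular `|det A + det B| ≤ 1`. -/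
theorem abs_det_add_abs_det_le_one (k : ℕ) (hk : 2 ≤ k)
    (A B : Matrix (Fin k) (Fin k) ℂ)
    (hrow : ∀ i : Fin k, (∑ j, ‖A i j‖ ^ 2) + (∑ j, ‖B i j‖ ^ 2) ≤ 1) :
    ‖A.det‖ + ‖B.det‖ ≤ 1 ∧ ‖A.det + B.det‖ ≤ 1 := by
  have key : ‖A.det‖ + ‖B.det‖ ≤ 1 := by
    have pA : ∀ i, 0 ≤ ∑ j, ‖A i j‖ ^ 2 := fun i => by positivity
    have pB : ∀ i, 0 ≤ ∑ j, ‖B i j‖ ^ 2 := fun i => by positivity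
    have hij : (⟨0, by omega⟩ : Fin k) ≠ ⟨1, by omega⟩ := by simp
    have hA := (hadamard_ineq_aux k A).trans (prod_le_two_aux k _ (fun i => Real.sqrt_nonneg _)
      (fun i => Real.sqrt_le_one.2 (by linarith [hrow i, pB i])) _ _ hij)
    have hB := (hadamard_ineq_aux k B).trans (prod_le_two_aux k _ (fun i => Real.sqrt_nonneg _)
      (fun i => Real.sqrt_le_one.2 (by linarith [hrow i, pA i])) _ _ hij)
    generalize (⟨0, by omega⟩ : Fin k) = x at *
    generalize (⟨1, by omega⟩ : Fin k) = y at *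
    have := Real.sq_sqrt (pA x)
    have := Real.sq_sqrt (pA y)
    have := Real.sq_sqrt (pB x)
    have := Real.sq_sqrt (pB y)
    have := two_mul_le_add_sq √(∑ j, ‖A x j‖ ^ 2) √(∑ j, ‖A y j‖ ^ 2)
    have := two_mul_le_add_sq √(∑ j, ‖B x j‖ ^ 2) √(∑ j, ‖B y j‖ ^ 2)
    linarith [hrow x, hrow y]
  exact ⟨key, (norm_add_le _ _).trans key⟩
end

section
/- Let n and k be natural numbers with 2 ≤ k and 2k ≤ n, and let g be an n × n unitary complex matrix. Let A be the k × k submatrix of g with entries A i j = g (j) (i) for i, j ∈ Fin k, and let B be the k × k matrix with entries B i j = g (j + k) (i). Then |det A + det B| ≤ 1; equivalently, (1/√2)·|det A + det B| ≤ 1/√2. -/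
theorem hadamard_aux {k : ℕ} (A : Matrix (Fin k) (Fin k) ℂ) :
    ‖A.det‖ ≤ ∏ i, ‖(WithLp.toLp 2 (A i) : EuclideanSpace ℂ (Fin k))‖ := by
  classical
  set v : Fin k → EuclideanSpace ℂ (Fin k) := fun i => WithLp.toLp 2 (A i) with hv
  have hd : Module.finrank ℂ (EuclideanSpace ℂ (Fin k)) = Fintype.card (Fin k) := by simp
  let b := InnerProductSpace.gramSchmidtOrthonormalBasis hd v
  have hb : b.toBasis.det v = ∏ i, inner ℂ (b i) (v i) :=
    InnerProductSpace.gramSchmidtOrthonormalBasis_det hd v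
  let e := EuclideanSpace.basisFun (Fin k) ℂ
  have h1 : A.det = e.toBasis.det v := by
    rw [Module.Basis.det_apply, ← Matrix.det_transpose]
    congr 1
  have h2 : e.toBasis.det v = e.toBasis.det b * b.toBasis.det v := by
    rw [Module.Basis.det_apply, Module.Basis.det_apply, Module.Basis.det_apply, ← Matrix.det_mul]
    rw [← b.coe_toBasis, Module.Basis.toMatrix_mul_toMatrix]
  have h3 : ‖e.toBasis.det b‖ = 1 := e.det_to_matrix_orthonormalBasis b
  rw [h1, h2, norm_mul, h3, one_mul, hb, norm_prod]
  refine Finset.prod_le_prod (fun i _ => norm_nonneg _) fun i _ => ?_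
  refine (norm_inner_le_norm (b i) (v i)).trans ?_
  rw [b.orthonormal.1 i, one_mul]

theorem prod_aux {k : ℕ} (hk : 2 ≤ k) (a b : Fin k → ℝ) (ha : ∀ i, 0 ≤ a i) (hb : ∀ i, 0 ≤ b i)
    (h : ∀ i, a i ^ 2 + b i ^ 2 ≤ 1) : ∏ i, a i + ∏ i, b i ≤ 1 := by
  obtain ⟨m, rfl⟩ := Nat.exists_eq_add_of_le' hk
  have key : ∀ c : Fin (m + 2) → ℝ, (∀ i, 0 ≤ c i) → (∀ i, c i ^ 2 ≤ 1) →
      ∏ i, c i ≤ c 0 * c 1 := by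
    intro c hc hc1
    rw [Fin.prod_univ_succ, Fin.prod_univ_succ]
    have h1 : ∏ i : Fin m, c i.succ.succ ≤ 1 :=
      Finset.prod_le_one (fun i _ => hc _) fun i _ => by
        nlinarith [hc i.succ.succ, hc1 i.succ.succ]
    have := mul_le_mul_of_nonneg_left h1 (mul_nonneg (hc 0) (hc 1))
    simpa [mul_assoc] using this
  have h1 := key a ha fun i => by nlinarith [h i, sq_nonneg (b i)]
  have h2 := key b hb fun i => by nlinarith [h i, sq_nonneg (a i)]
  nlinarith [h 0, h 1, sq_nonneg (a 0 - a 1), sq_nonneg (b 0 - b 1)]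


/-- For `2 ≤ k`, `2k ≤ n` and a unitary matrix `g ∈ U(n)`, the `k × k` matrices
`A i j = g j i` and `B i j = g (j+k) i` (on the first `k` columns of `g`) satisfy
`|det A + det B| ≤ 1`; equivalently `(1/√2)|det A + det B| ≤ 1/√2`. -/
theorem abs_det_submatrices_unitary_le_one (n k : ℕ) (hk : 2 ≤ k) (hkn : 2 * k ≤ n)
    (g : Matrix.unitaryGroup (Fin n) ℂ)
    (A B : Matrix (Fin k) (Fin k) ℂ)
    (hA : ∀ i j : Fin k,
      A i j = (g : Matrix (Fin n) (Fin n) ℂ) (Fin.castLE (by omega) j) (Fin.castLE (by omega) i))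
    (hB : ∀ i j : Fin k,
      B i j = (g : Matrix (Fin n) (Fin n) ℂ) (⟨(j : ℕ) + k, by omega⟩ : Fin n)
        (Fin.castLE (by omega) i)) :
    ‖A.det + B.det‖ ≤ 1 ∧
      (1 / Real.sqrt 2) * ‖A.det + B.det‖ ≤ 1 / Real.sqrt 2 := by
  have hcol : ∀ i : Fin n, ∑ j, ‖(g : Matrix (Fin n) (Fin n) ℂ) j i‖ ^ 2 = 1 := by
    intro i
    have h := congrFun (congrFun (Matrix.mem_unitaryGroup_iff'.1 g.2) i) i
    rw [Matrix.mul_apply] at h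
    simp only [Matrix.star_apply, Matrix.one_apply_eq, RCLike.star_def, Complex.conj_mul'] at h
    exact_mod_cast h
  have main : ‖A.det + B.det‖ ≤ 1 := by
    refine (norm_add_le _ _).trans
      ((add_le_add (hadamard_aux A) (hadamard_aux B)).trans ?_)
    refine prod_aux hk _ _ (fun i => norm_nonneg _) (fun i => norm_nonneg _) fun i => ?_
    rw [EuclideanSpace.norm_sq_eq, EuclideanSpace.norm_sq_eq]
    rw [← hcol (Fin.castLE (by omega) i)]
    let f : Fin k ⊕ Fin k → Fin n :=
      Sum.elim (Fin.castLE (by omega)) (fun j => ⟨(j : ℕ) + k, by omega⟩)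
    have hf : Function.Injective f := by
      rintro (x | x) (y | y) hxy <;> simp [f, Fin.ext_iff] at hxy ⊢ <;> omega
    calc _ = ∑ s, ‖(g : Matrix (Fin n) (Fin n) ℂ) (f s) (Fin.castLE (by omega) i)‖ ^ 2 := by
          rw [Fintype.sum_sum_type]
          simp [f, hA, hB]
      _ = ∑ j ∈ Finset.univ.map ⟨f, hf⟩,
          ‖(g : Matrix (Fin n) (Fin n) ℂ) j (Fin.castLE (by omega) i)‖ ^ 2 := by
          rw [Finset.sum_map]; rfl
      _ ≤ _ := Finset.sum_le_sum_of_subset_of_nonneg (Finset.subset_univ _)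
          fun _ _ _ => by positivity
  exact ⟨main, mul_le_of_le_one_right (by positivity) main⟩
end

section
/- Let n ≥ 1, p ≥ 1, and let A, B₁, …, B_p be n × n skew-Hermitian complex matrices (Mᴴ = −M) with operator norm ‖A‖ ≤ 1. Let u : ℝ → Fin p → ℝ be continuous, and let X : ℝ → ℂⁿ be differentiable with ‖X 0‖ = 1 and, for all t, X′(t) = A · X(t) + ∑_{i} uᵢ(t) • (Bᵢ · X(t)). Let G be the topological closure in U(n) of the subgroup generated by {exp(s • Bᵢ) : s ∈ ℝ, i ∈ Fin p}. Then for every T ≥ 0, inf_{g ∈ G} ‖X(0) − g · X(T)‖ ≤ T. -/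
open scoped Matrix
open scoped Topology

section Helpers
open scoped Matrix.Norms.L2Operator

theorem aux_exp_unitary {n : ℕ} (M : Matrix (Fin n) (Fin n) ℂ) (hM : Mᴴ = -M) (s : ℝ) :
    NormedSpace.exp (s • M) ∈ Matrix.unitaryGroup (Fin n) ℂ := by
  letI : NormedAlgebra ℚ (Matrix (Fin n) (Fin n) ℂ) := NormedAlgebra.restrictScalars ℚ ℂ _
  refine NormedSpace.exp_mem_unitary_of_mem_skewAdjoint ?_
  rw [skewAdjoint.mem_iff, Matrix.star_eq_conjTranspose, Matrix.conjTranspose_smul, hM]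
  simp

theorem aux_curve {n p : ℕ} (B : Fin p → Matrix (Fin n) (Fin n) ℂ) (hB : ∀ i, (B i)ᴴ = -(B i))
    (H : Subgroup (Matrix.unitaryGroup (Fin n) ℂ))
    (hH : ∀ g : Matrix.unitaryGroup (Fin n) ℂ, (∃ s : ℝ, ∃ i : Fin p,
      (g : Matrix (Fin n) (Fin n) ℂ) = NormedSpace.exp (s • B i)) → g ∈ H)
    (c : Fin p → ℝ) (S : Finset (Fin p)) :
    ∃ P : ℝ → Matrix.unitaryGroup (Fin n) ℂ, (∀ s, P s ∈ H) ∧ P 0 = 1 ∧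
      HasDerivAt (fun s => (P s : Matrix (Fin n) (Fin n) ℂ)) (∑ i ∈ S, c i • B i) 0 := by
  induction S using Finset.induction_on with
  | empty => exact ⟨fun _ => 1, fun _ => H.one_mem, rfl, by simpa using hasDerivAt_const _ _⟩
  | insert a S ha ih =>
    obtain ⟨P, h1, h2, h3⟩ := ih
    refine ⟨fun s => ⟨_, aux_exp_unitary (B a) (hB a) (s * c a)⟩ * P s, ?_, ?_, ?_⟩
    · exact fun s => H.mul_mem (hH _ ⟨_, a, rfl⟩) (h1 s)
    · apply Subtype.ext
      simp [h2]
    · have h4 : HasDerivAt (fun s : ℝ => NormedSpace.exp (s • (c a • B a)))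
          (NormedSpace.exp ((0:ℝ) • (c a • B a)) * (c a • B a)) 0 :=
        hasDerivAt_exp_smul_const (𝕂 := ℝ) (c a • B a) (0:ℝ)
      have h5 := h4.mul h3
      rw [Finset.sum_insert ha]
      simp only [h2, zero_smul, NormedSpace.exp_zero, one_mul, OneMemClass.coe_one, mul_one] at h5
      refine h5.congr_of_eventuallyEq (Filter.Eventually.of_forall fun s => ?_)
      simp [mul_smul]

theorem aux_app {n : ℕ} (P : ℝ → Matrix (Fin n) (Fin n) ℂ) (M : Matrix (Fin n) (Fin n) ℂ)
    (t : ℝ) (h : HasDerivAt P M t) (v : EuclideanSpace ℂ (Fin n)) :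
    HasDerivAt (fun s => Matrix.toEuclideanLin (P s) v) (Matrix.toEuclideanLin M v) t := by
  let L : Matrix (Fin n) (Fin n) ℂ →ₗ[ℝ] EuclideanSpace ℂ (Fin n) :=
    { toFun := fun Q => Matrix.toEuclideanLin Q v
      map_add' := by intro a b; simp
      map_smul' := by
        intro r a
        have : r • a = (r : ℂ) • a := by ext; simp
        rw [this, map_smul]; simp }
  exact (LinearMap.toContinuousLinearMap L).hasFDerivAt.comp_hasDerivAt t h

end Helpers

theorem aux_inner {n : ℕ} (M : Matrix (Fin n) (Fin n) ℂ) (hM : Mᴴ = -M)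
    (v : EuclideanSpace ℂ (Fin n)) : (inner ℂ v (Matrix.toEuclideanLin M v)).re = 0 := by
  have h := LinearMap.adjoint_inner_left (Matrix.toEuclideanLin M) v v
  rw [← Matrix.toEuclideanLin_conjTranspose_eq_adjoint, hM, map_neg, LinearMap.neg_apply,
    inner_neg_left, ← inner_conj_symm] at h
  have := congrArg Complex.re h
  rw [Complex.neg_re, Complex.conj_re] at this
  linarith

theorem aux_real {n : ℕ} (v w : EuclideanSpace ℂ (Fin n)) :
    inner ℝ v w = (inner ℂ v w).re := by
  rw [real_inner_eq_norm_add_mul_self_sub_norm_mul_self_sub_norm_mul_self_div_two]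
  exact (re_inner_eq_norm_add_mul_self_sub_norm_mul_self_sub_norm_mul_self_div_two (𝕜 := ℂ) v w).symm

theorem aux_norm {n : ℕ} (g : Matrix.unitaryGroup (Fin n) ℂ) (v : EuclideanSpace ℂ (Fin n)) :
    ‖Matrix.toEuclideanLin (g : Matrix (Fin n) (Fin n) ℂ) v‖ = ‖v‖ := by
  have h := LinearMap.adjoint_inner_left (Matrix.toEuclideanLin (g : Matrix (Fin n) (Fin n) ℂ))
    v (Matrix.toEuclideanLin (g : Matrix (Fin n) (Fin n) ℂ) v)
  rw [← Matrix.toEuclideanLin_conjTranspose_eq_adjoint] at h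
  have h2 : Matrix.toEuclideanLin (g : Matrix (Fin n) (Fin n) ℂ)ᴴ
      (Matrix.toEuclideanLin (g : Matrix (Fin n) (Fin n) ℂ) v) = v := by
    have : (g : Matrix (Fin n) (Fin n) ℂ)ᴴ * (g : Matrix (Fin n) (Fin n) ℂ) = 1 :=
      Matrix.UnitaryGroup.star_mul_self g
    simp [Matrix.toLpLin_apply, this]
  rw [h2, inner_self_eq_norm_sq_to_K, inner_self_eq_norm_sq_to_K] at h
  have h3 : ‖v‖ ^ 2 = ‖Matrix.toEuclideanLin (g : Matrix (Fin n) (Fin n) ℂ) v‖ ^ 2 := by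
    exact_mod_cast h
  exact ((sq_eq_sq₀ (norm_nonneg _) (norm_nonneg _)).1 h3).symm

theorem aux_mul {n : ℕ} (g k : Matrix (Fin n) (Fin n) ℂ) (v : EuclideanSpace ℂ (Fin n)) :
    Matrix.toEuclideanLin (g * k) v = Matrix.toEuclideanLin g (Matrix.toEuclideanLin k v) := by
  simp [Matrix.toLpLin_apply]


/-- Consider the quantum control system `Ẋ = AX + ∑ᵢ uᵢ(t) Bᵢ X` on the unit sphere
of `ℂⁿ`, with skew-Hermitian matrices `A, B₁, …, B_p`, `‖A‖ ≤ 1` (operator norm),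
continuous controls `u`, and a differentiable trajectory `X` with `‖X 0‖ = 1`.
Let `G` be the topological closure in `U(n)` of the subgroup generated by the
one-parameter groups `exp(s Bᵢ)`. Then for every `T ≥ 0`,
`inf_{g ∈ G} ‖X(0) − g X(T)‖ ≤ T`. -/
theorem orbit_dist_le_time (n p : ℕ) (hn : 1 ≤ n) (hp : 1 ≤ p)
    (A : Matrix (Fin n) (Fin n) ℂ) (B : Fin p → Matrix (Fin n) (Fin n) ℂ)
    (hA : Aᴴ = -A) (hB : ∀ i, (B i)ᴴ = -(B i))
    (hAnorm : ‖Matrix.toEuclideanCLM (𝕜 := ℂ) A‖ ≤ 1)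
    (u : ℝ → Fin p → ℝ) (hu : Continuous u)
    (X : ℝ → EuclideanSpace ℂ (Fin n)) (hX0 : ‖X 0‖ = 1)
    (hX : ∀ t : ℝ, HasDerivAt X
      (Matrix.toEuclideanLin A (X t) + ∑ i, u t i • Matrix.toEuclideanLin (B i) (X t)) t)
    (G : Set (Matrix.unitaryGroup (Fin n) ℂ))
    (hG : G = closure (↑(Subgroup.closure {g : Matrix.unitaryGroup (Fin n) ℂ |
      ∃ s : ℝ, ∃ i : Fin p, (g : Matrix (Fin n) (Fin n) ℂ) = NormedSpace.exp (s • B i)})))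
    (T : ℝ) (hT : 0 ≤ T) :
    sInf {r : ℝ | ∃ g ∈ G,
        r = ‖X 0 - Matrix.toEuclideanLin (g : Matrix (Fin n) (Fin n) ℂ) (X T)‖} ≤ T := by
  classical
  set H := Subgroup.closure {g : Matrix.unitaryGroup (Fin n) ℂ |
      ∃ s : ℝ, ∃ i : Fin p, (g : Matrix (Fin n) (Fin n) ℂ) = NormedSpace.exp (s • B i)} with hHdef
  have hH : ∀ g : Matrix.unitaryGroup (Fin n) ℂ, (∃ s : ℝ, ∃ i : Fin p,
      (g : Matrix (Fin n) (Fin n) ℂ) = NormedSpace.exp (s • B i)) → g ∈ H :=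
    fun g hg => Subgroup.subset_closure hg
  -- the norm is preserved
  have hXn : ∀ t, ‖X t‖ = 1 := by
    have hd : ∀ t, HasDerivAt (fun t => ‖X t‖ ^ 2) 0 t := by
      intro t
      have h := (hX t).norm_sq
      convert h using 1
      rw [inner_add_right, inner_sum]
      simp only [inner_smul_right, aux_real, aux_inner A hA, fun i => aux_inner (B i) (hB i)]
      simp
    intro t
    have h := is_const_of_deriv_eq_zero (fun t => (hd t).differentiableAt)
      (fun t => (hd t).deriv) t 0
    simp only [hX0] at h
    nlinarith [norm_nonneg (X t)]
  let d : ℝ → ℝ := fun t => ⨅ g : H,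
    ‖X 0 - Matrix.toEuclideanLin ((g : Matrix.unitaryGroup (Fin n) ℂ) : Matrix (Fin n) (Fin n) ℂ) (X t)‖
  have hbdd : ∀ t, BddBelow (Set.range fun g : H => ‖X 0 - Matrix.toEuclideanLin
      ((g : Matrix.unitaryGroup (Fin n) ℂ) : Matrix (Fin n) (Fin n) ℂ) (X t)‖) := by
    intro t
    refine ⟨0, ?_⟩
    rintro _ ⟨g, rfl⟩
    exact norm_nonneg _
  have key : ∀ (t z : ℝ) (k : Matrix.unitaryGroup (Fin n) ℂ), k ∈ H →
      d z ≤ d t + ‖X z - Matrix.toEuclideanLin (k : Matrix (Fin n) (Fin n) ℂ) (X t)‖ := by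
    intro t z k hk
    rw [← sub_le_iff_le_add]
    refine le_ciInf fun g => ?_
    rw [sub_le_iff_le_add]
    have hm : (g : Matrix.unitaryGroup (Fin n) ℂ) * k⁻¹ ∈ H := H.mul_mem g.2 (H.inv_mem hk)
    refine (ciInf_le (hbdd z) ⟨_, hm⟩).trans ?_
    have e : Matrix.toEuclideanLin ((g : Matrix.unitaryGroup (Fin n) ℂ) : Matrix (Fin n) (Fin n) ℂ) (X t)
        = Matrix.toEuclideanLin (((g : Matrix.unitaryGroup (Fin n) ℂ) * k⁻¹ : Matrix.unitaryGroup (Fin n) ℂ) : Matrix (Fin n) (Fin n) ℂ)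
          (Matrix.toEuclideanLin (k : Matrix (Fin n) (Fin n) ℂ) (X t)) := by
      rw [← aux_mul, ← Submonoid.coe_mul, inv_mul_cancel_right]
    rw [e, ← aux_norm ((g : Matrix.unitaryGroup (Fin n) ℂ) * k⁻¹)
      (X z - Matrix.toEuclideanLin (k : Matrix (Fin n) (Fin n) ℂ) (X t)), map_sub]
    refine le_trans (le_of_eq ?_) (norm_sub_le _ _)
    congr 1
    abel
  have hXc : Continuous X := continuous_iff_continuousAt.2 fun t => (hX t).continuousAt
  have key1 : ∀ t z, d z ≤ d t + ‖X z - X t‖ := by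
    intro t z
    have := key t z 1 H.one_mem
    simpa using this
  have hdc : Continuous d := by
    rw [continuous_iff_continuousAt]
    intro t
    rw [ContinuousAt, tendsto_iff_norm_sub_tendsto_zero]
    have h0 : Filter.Tendsto (fun z => ‖X z - X t‖) (𝓝 t) (𝓝 0) :=
      tendsto_iff_norm_sub_tendsto_zero.1 (hXc.tendsto t)
    refine squeeze_zero (fun _ => norm_nonneg _) (fun z => ?_) h0
    rw [Real.norm_eq_abs, abs_le]
    have h1 := key1 t z
    have h2 := key1 z t
    rw [norm_sub_rev] at h2
    constructor <;> linarith
  have hslope : ∀ t r : ℝ, 1 < r → ∃ᶠ z in 𝓝[>] t, slope d t z < r := by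
    intro t r hr
    obtain ⟨P, hP1, hP2, hP3⟩ := aux_curve B hB H hH (u t) Finset.univ
    have hP4 : HasDerivAt (fun z => Matrix.toEuclideanLin (P (z - t) : Matrix (Fin n) (Fin n) ℂ) (X t))
        (Matrix.toEuclideanLin (∑ i, u t i • B i) (X t)) t := by
      have h := aux_app _ _ _ hP3 (X t)
      rw [← sub_self t] at h
      exact h.comp_sub_const t t
    have hsum : Matrix.toEuclideanLin (∑ i, u t i • B i) (X t)
        = ∑ i, u t i • Matrix.toEuclideanLin (B i) (X t) := by
      rw [map_sum, LinearMap.sum_apply]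
      refine Finset.sum_congr rfl fun i _ => ?_
      have : u t i • B i = (u t i : ℂ) • B i := by ext; simp
      rw [this, map_smul]; simp
    have hY := (hX t).sub hP4
    rw [hsum, add_sub_cancel_right] at hY
    have hA1 : ‖Matrix.toEuclideanLin A (X t)‖ < r := by
      refine lt_of_le_of_lt ?_ hr
      have := (Matrix.toEuclideanCLM (𝕜 := ℂ) A).le_of_opNorm_le hAnorm (X t)
      rw [hXn, one_mul] at this
      exact this
    have hev := (hY.hasDerivWithinAt (s := Set.Ioi t)).limsup_norm_slope_le hA1
    refine Filter.Eventually.frequently ?_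
    filter_upwards [hev, self_mem_nhdsWithin] with z hz hzt
    have hzt' : 0 < z - t := sub_pos.2 hzt
    have hk := key t z _ (hP1 (z - t))
    simp only [Pi.sub_apply, sub_self, hP2, OneMemClass.coe_one] at hz
    have h1 : Matrix.toEuclideanLin (1 : Matrix (Fin n) (Fin n) ℂ) (X t) = X t := by simp
    rw [h1, sub_self, sub_zero, Real.norm_of_nonneg hzt'.le] at hz
    refine lt_of_le_of_lt ?_ hz
    rw [slope_def_field, div_eq_inv_mul]
    gcongr
    linarith
  have hd0 : d 0 ≤ 0 := by
    refine (ciInf_le (hbdd 0) 1).trans ?_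
    simp
  have hmain : d T ≤ T := by
    exact image_le_of_liminf_slope_right_le_deriv_boundary (f := d) (a := 0) (b := T)
      (B := fun x => x) (B' := fun _ => 1) hdc.continuousOn hd0 continuousOn_id
      (fun x _ => hasDerivWithinAt_id x _) (fun x _ r hr => hslope x r hr) ⟨hT, le_rfl⟩
  refine le_trans ?_ hmain
  refine le_ciInf fun g => csInf_le ?_ ?_
  · refine ⟨0, ?_⟩
    rintro _ ⟨g, _, rfl⟩
    exact norm_nonneg _
  · exact ⟨g, hG ▸ subset_closure g.2, rfl⟩
end

section
/- Let E be a real inner product space, let T be a real number with 0 ≤ T ≤ π, and let γ : ℝ → E satisfy ‖γ(t)‖ = 1 for all t ∈ [0, T] and be 1-Lipschitz on [0, T] (‖γ(s) − γ(t)‖ ≤ |s − t| for s, t ∈ [0, T]). Then ‖γ(T) − γ(0)‖ ≤ 2 sin(T/2). -/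
lemma chord_eq_aux {E : Type*} [NormedAddCommGroup E] [InnerProductSpace ℝ E] (x y : E)
    (hx : ‖x‖ = 1) (hy : ‖y‖ = 1) :
    ‖x - y‖ = 2 * Real.sin (InnerProductGeometry.angle x y / 2) := by
  have h0 := InnerProductGeometry.angle_nonneg x y
  have h1 := InnerProductGeometry.angle_le_pi x y
  have hs : 0 ≤ Real.sin (InnerProductGeometry.angle x y / 2) :=
    Real.sin_nonneg_of_nonneg_of_le_pi (by linarith) (by linarith)
  have h2 := InnerProductGeometry.norm_sub_sq_eq_norm_sq_add_norm_sq_sub_two_mul_norm_mul_norm_mul_cos_angle x y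
  rw [hx, hy] at h2
  have h3 : Real.cos (InnerProductGeometry.angle x y)
      = 1 - 2 * Real.sin (InnerProductGeometry.angle x y / 2) ^ 2 := by
    have := Real.cos_two_mul (InnerProductGeometry.angle x y / 2)
    rw [mul_div_cancel₀ _ (two_ne_zero)] at this
    have h4 := Real.sin_sq_add_cos_sq (InnerProductGeometry.angle x y / 2)
    linarith
  rw [h3] at h2
  refine (sq_eq_sq₀ (norm_nonneg _) (by positivity)).1 ?_
  nlinarith

lemma angle_le_aux {E : Type*} [NormedAddCommGroup E] [InnerProductSpace ℝ E] (x y : E)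
    (hx : ‖x‖ = 1) (hy : ‖y‖ = 1) (h : ℝ) (hh0 : 0 ≤ h) (hh : h ≤ 1) (hxy : ‖x - y‖ ≤ h) :
    InnerProductGeometry.angle x y ≤ h + h ^ 2 := by
  have h0 := InnerProductGeometry.angle_nonneg x y
  have h1 := InnerProductGeometry.angle_le_pi x y
  rw [chord_eq_aux x y hx hy] at hxy
  obtain ⟨u, hu⟩ : ∃ u, u = InnerProductGeometry.angle x y / 2 := ⟨_, rfl⟩
  rw [← hu] at hxy
  have hu0 : 0 ≤ u := by linarith
  have hj := Real.mul_le_sin hu0 (by linarith)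
  have hle : u ≤ h := by
    have : 1 / 2 ≤ 2 / Real.pi := by
      rw [div_le_div_iff₀ (by norm_num) Real.pi_pos]; linarith [Real.pi_le_four]
    nlinarith
  have hc : u - u ^ 3 / 4 ≤ Real.sin u := by
    rcases hu0.eq_or_lt with h | h
    · simp [← h]
    · have h6 := Real.sin_gt_sub_cube h
      have h7 : 0 < u ^ 3 := by positivity
      linarith
  have h3 : u ^ 3 ≤ h ^ 3 := by gcongr
  have h4 : h ^ 3 ≤ h ^ 2 := pow_le_pow_of_le_one hh0 hh (by norm_num)
  nlinarith

/-- If `γ` is a curve on the unit sphere of a real inner product space which is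
`1`-Lipschitz on `[0, T]` with `0 ≤ T ≤ π`, then the chordal distance between its
endpoints is at most `2 sin(T/2)`. -/
theorem chord_le_two_sin_half (E : Type*) [NormedAddCommGroup E] [InnerProductSpace ℝ E]
    (T : ℝ) (hT0 : 0 ≤ T) (hTpi : T ≤ Real.pi) (γ : ℝ → E)
    (hsphere : ∀ t ∈ Set.Icc (0 : ℝ) T, ‖γ t‖ = 1)
    (hlip : ∀ s ∈ Set.Icc (0 : ℝ) T, ∀ t ∈ Set.Icc (0 : ℝ) T, ‖γ s - γ t‖ ≤ |s - t|) :
    ‖γ T - γ 0‖ ≤ 2 * Real.sin (T / 2) := by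
  by_cases hT : T = 0
  · subst hT; simp
  have hTp : 0 < T := lt_of_le_of_ne hT0 (Ne.symm hT)
  have m0 : (0 : ℝ) ∈ Set.Icc (0 : ℝ) T := ⟨le_rfl, hT0⟩
  have mT : T ∈ Set.Icc (0 : ℝ) T := ⟨hT0, le_rfl⟩
  have key : InnerProductGeometry.angle (γ T) (γ 0) ≤ T := by
    refine le_of_forall_pos_le_add fun ε hε => ?_
    obtain ⟨n, hn⟩ := exists_nat_gt (T + T ^ 2 / ε)
    have hq : 0 ≤ T ^ 2 / ε := by positivity
    have hn0 : (0 : ℝ) < n := by linarith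
    obtain ⟨h, hh⟩ : ∃ h, h = T / n := ⟨_, rfl⟩
    have hnh : n * h = T := by rw [hh]; field_simp
    have hh0 : 0 ≤ h := by rw [hh]; positivity
    have hh1 : h ≤ 1 := by rw [hh, div_le_one hn0]; linarith
    have mem : ∀ k : ℕ, k ≤ n → (k : ℝ) * h ∈ Set.Icc (0 : ℝ) T := by
      intro k hk
      refine ⟨by positivity, ?_⟩
      rw [← hnh]
      gcongr
    have ind : ∀ k : ℕ, k ≤ n →
        InnerProductGeometry.angle (γ (k * h)) (γ 0) ≤ k * (h + h ^ 2) := by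
      intro k
      induction k with
      | zero =>
        intro _
        have : γ 0 ≠ 0 := by
          intro h0
          have := hsphere 0 m0
          simp [h0] at this
        simp [InnerProductGeometry.angle_self this]
      | succ k ih =>
        intro hk
        have ih := ih (by omega)
        have m1 := mem k (by omega)
        have m2 := mem (k + 1) hk
        have tri := InnerProductGeometry.angle_le_angle_add_angle
          (γ ((k + 1 : ℕ) * h)) (γ (k * h)) (γ 0)
        have st := angle_le_aux _ _ (hsphere _ m2) (hsphere _ m1) h hh0 hh1 (by
          refine (hlip _ m2 _ m1).trans (le_of_eq ?_)
          push_cast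
          rw [show ((k : ℝ) + 1) * h - k * h = h by ring, abs_of_nonneg hh0])
        push_cast at *
        linarith
    have := ind n le_rfl
    rw [hnh] at this
    have h5 : n * h ^ 2 ≤ ε := by
      rw [hh]
      have : T ^ 2 / ε < n := by linarith
      rw [div_lt_iff₀ hε] at this
      have e : (n : ℝ) * (T / n) ^ 2 = T ^ 2 / n := by field_simp
      rw [e, div_le_iff₀ hn0]
      linarith
    linarith
  rw [chord_eq_aux _ _ (hsphere _ mT) (hsphere _ m0)]
  have h0 := InnerProductGeometry.angle_nonneg (γ T) (γ 0)
  have := Real.sin_le_sin_of_le_of_le_pi_div_two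
    (x := InnerProductGeometry.angle (γ T) (γ 0) / 2) (y := T / 2)
    (by linarith [Real.pi_pos]) (by linarith) (by linarith)
  linarith
end
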